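/- Let A₁, …, Aₙ be positive invertible operators on H with mI ≤ Aⱼ ≤ MI (j = 1, …, n) for some scalars 0 < m < M, let Φ : B(H) → B(K) be a unital positive linear map, let h = M/m, and let F (on H) and G (on K) each satisfy the arithmetic–harmonic sandwich for the probability vector ω. Then for every r ≥ 1, (4Mʳmʳ/(Mʳ + mʳ)²)·K(h, −r)⁻¹·K(h, r)⁻¹·Φ(F(A₁, …, Aₙ)ʳ) ≤ G(Φ(A₁ʳ), …, Φ(Aₙʳ)). -/

import Mathlib

noncomputable section

/-- The arithmetic–harmonic sandwich for the probability vector `ω`: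
`(∑ ωⱼ Bⱼ⁻¹)⁻¹ ≤ F (B₁, …, Bₙ) ≤ ∑ ωⱼ Bⱼ` for all positive invertible `B₁, …, Bₙ`,
and `F` takes values in the positive invertible operators. -/
def IsAHSandwich {E : Type*} [NormedAddCommGroup E] [InnerProductSpace ℂ E]
    [CompleteSpace E] {n : ℕ} (ω : Fin n → ℝ)
    (F : (Fin n → (E →L[ℂ] E)) → (E →L[ℂ] E)) : Prop :=
  ∀ B : Fin n → (E →L[ℂ] E), (∀ j, 0 ≤ B j) → (∀ j, IsUnit (B j)) →
    (0 ≤ F B ∧ IsUnit (F B)) ∧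
    Ring.inverse (∑ j, ω j • Ring.inverse (B j)) ≤ F B ∧
    F B ≤ ∑ j, ω j • B j

/-- The generalized Kantorovich constant `K(h, p)`, with `K(h, 0) = K(h, 1) = 1`. -/
def Kconst (h p : ℝ) : ℝ :=
  if p = 0 ∨ p = 1 then 1
  else ((h ^ p - h) / ((p - 1) * (h - 1))) *
    (((p - 1) / p) * ((h ^ p - 1) / (h ^ p - h))) ^ p

lemma one_add_mul_sub_one_le_rpow {p x : ℝ} (hp : p < 0 ∨ 1 ≤ p) (hx : 0 < x) :
    1 + p * (x - 1) ≤ x ^ p := by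
  rcases hp with hp | hp
  · rw [Real.rpow_def_of_pos hx]
    nlinarith [Real.add_one_le_exp (Real.log x * p), Real.log_le_sub_one_of_pos hx]
  · simpa using one_add_mul_self_le_rpow_one_add (s := x - 1) (by linarith) hp

/-- The chord of `x ↦ x ^ p` over `[1, h]` is at most `K(h, p) x ^ p`. -/
lemma chord_le_Kconst_mul_rpow {h p x : ℝ} (hh : 1 < h) (hp : p < 0 ∨ 1 < p) (hx : 0 < x) :
    ((h ^ p - 1) * x + (h - h ^ p)) / (h - 1) ≤ Kconst h p * x ^ p := by
  have hh0 : 0 < h - 1 := by linarith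
  have hp0 : p ≠ 0 := by rcases hp with hp | hp <;> linarith
  have hp1 : p - 1 ≠ 0 := by rcases hp with hp | hp <;> linarith
  have hc : 0 < (h ^ p - h) / ((p - 1) * (h - 1)) ∧
      0 < ((p - 1) / p) * ((h ^ p - 1) / (h ^ p - h)) := by
    rcases hp with hp | hp
    · have h1 : h ^ p < 1 := Real.rpow_lt_one_of_one_lt_of_neg hh hp
      exact ⟨div_pos_of_neg_of_neg (by linarith) (by nlinarith),
        mul_pos (div_pos_of_neg_of_neg (by linarith) hp)
          (div_pos_of_neg_of_neg (by linarith) (by linarith))⟩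
    · have h1 : h < h ^ p := Real.self_lt_rpow_of_one_lt hh hp
      have h2 : 0 < p - 1 := by linarith
      exact ⟨div_pos (by linarith) (by positivity),
        mul_pos (div_pos h2 (by linarith)) (div_pos (by linarith) (by linarith))⟩
  have hd : h ^ p - h ≠ 0 := fun h0 ↦ by simp [h0] at hc
  have hK : Kconst h p = ((h ^ p - h) / ((p - 1) * (h - 1))) *
      (((p - 1) / p) * ((h ^ p - 1) / (h ^ p - h))) ^ p :=
    if_neg (by rintro (h0 | h0) <;> simp_all)
  rw [hK, mul_assoc, ← Real.mul_rpow hc.2.le hx.le]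
  refine le_trans (le_of_eq ?_) (mul_le_mul_of_nonneg_left
    (one_add_mul_sub_one_le_rpow (hp.imp_right le_of_lt) (mul_pos hc.2 hx)) hc.1.le)
  field_simp
  ring

lemma one_le_Kconst {h p : ℝ} (hh : 1 < h) (hp : p < 0 ∨ 1 ≤ p) : 1 ≤ Kconst h p := by
  rcases eq_or_ne p 1 with rfl | hp1
  · simp [Kconst]
  · have key := chord_le_Kconst_mul_rpow hh
      (hp.imp_right fun h1 ↦ lt_of_le_of_ne h1 hp1.symm) one_pos
    have hh0 : h - 1 ≠ 0 := by linarith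
    rwa [Real.one_rpow, mul_one, mul_one, sub_add_sub_cancel', div_self hh0] at key

lemma exists_affine_between_rpow {m M r : ℝ} (hm : 0 < m) (hmM : m < M) (hr : 1 ≤ r) :
    ∃ α β : ℝ, 0 ≤ β ∧ ∀ t ∈ Set.Icc m M,
      t ^ r ≤ α + β * t ∧ α + β * t ≤ Kconst (M / m) r * t ^ r := by
  rcases hr.eq_or_lt with rfl | hr'
  · exact ⟨0, 1, zero_le_one, fun t _ ↦ by simp [Kconst]⟩
  have hM : 0 < M := hm.trans hmM
  have hh : 1 < M / m := (one_lt_div hm).2 hmM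
  have hd : 0 < M - m := sub_pos.2 hmM
  have hmr : 0 < m ^ r := Real.rpow_pos_of_pos hm r
  have hmono : m ^ r ≤ M ^ r := Real.rpow_le_rpow hm.le hmM.le (by linarith)
  refine ⟨(M * m ^ r - m * M ^ r) / (M - m), (M ^ r - m ^ r) / (M - m),
    div_nonneg (by linarith) hd.le, fun t ht ↦ ⟨?_, ?_⟩⟩
  · have hconv := (convexOn_rpow hr).2 (Set.mem_Ici.2 hm.le) (Set.mem_Ici.2 hM.le)
      (div_nonneg (sub_nonneg.2 ht.2) hd.le) (div_nonneg (sub_nonneg.2 ht.1) hd.le)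
      (by field_simp; ring)
    simp only [smul_eq_mul] at hconv
    have ht' : (M - t) / (M - m) * m + (t - m) / (M - m) * M = t := by field_simp; ring
    rw [ht'] at hconv
    refine hconv.trans (le_of_eq ?_)
    field_simp
    ring
  · have ht0 : 0 < t := hm.trans_le ht.1
    have key := mul_le_mul_of_nonneg_right
      (chord_le_Kconst_mul_rpow hh (Or.inr hr') (div_pos ht0 hm)) hmr.le
    rw [mul_assoc, Real.div_rpow ht0.le hm.le, div_mul_cancel₀ _ hmr.ne',
      Real.div_rpow hM.le hm.le] at key
    refine le_trans (le_of_eq ?_) key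
    have : M / m - 1 ≠ 0 := by linarith
    field_simp
    ring

section CStar

variable {B : Type*} [CStarAlgebra B] {ι : Type*} [Fintype ι] {ω : ι → ℝ}

lemma ringInverse_eq_cfc {a : B} (ha : IsSelfAdjoint a) (hu : IsUnit a) :
    Ring.inverse a = cfc (fun x : ℝ ↦ x⁻¹) a := by
  obtain ⟨u, rfl⟩ := hu
  rw [Ring.inverse_unit]
  exact (cfc_inv_id u ha).symm

lemma cfc_affine (α β : ℝ) {a : B} (ha : IsSelfAdjoint a) :
    cfc (fun x : ℝ ↦ α + β * x) a = α • (1 : B) + β • a := by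
  rw [cfc_const_add α (fun x : ℝ ↦ β * x) a, cfc_const_mul_id β a,
    Algebra.algebraMap_eq_smul_one]

lemma continuousOn_inv_spectrum {a : B} (hu : IsUnit a) :
    ContinuousOn (fun x : ℝ ↦ x⁻¹) (spectrum ℝ a) :=
  continuousOn_inv₀.mono fun _ hx ↦ by
    rintro rfl
    exact spectrum.zero_notMem ℝ hu hx

lemma continuousOn_rpow_spectrum {r : ℝ} (hr : 0 ≤ r) (a : B) :
    ContinuousOn (fun x : ℝ ↦ x ^ r) (spectrum ℝ a) :=
  (Real.continuous_rpow_const hr).continuousOn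

lemma weightedSum_affine (hω1 : ∑ j, ω j = 1) (α β : ℝ) (A : ι → B) :
    ∑ j, ω j • (α • (1 : B) + β • A j) = α • (1 : B) + β • ∑ j, ω j • A j := by
  simp_rw [smul_add]
  rw [Finset.sum_add_distrib, ← Finset.sum_smul, hω1, one_smul, Finset.smul_sum]
  simp_rw [smul_comm β]

variable [PartialOrder B] [StarOrderedRing B]

lemma spectrum_subset_Icc_of_smul_one_le {p q : ℝ} {a : B} (ha : IsSelfAdjoint a)
    (h1 : p • (1 : B) ≤ a) (h2 : a ≤ q • (1 : B)) : spectrum ℝ a ⊆ Set.Icc p q := by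
  rw [← Algebra.algebraMap_eq_smul_one] at h1 h2
  exact fun x hx ↦ ⟨(algebraMap_le_iff_le_spectrum ha).1 h1 x hx,
    (le_algebraMap_iff_spectrum_le ha).1 h2 x hx⟩

lemma isUnit_of_pos_smul_one_le {p : ℝ} {a : B} (hp : 0 < p) (ha : IsSelfAdjoint a)
    (h1 : p • (1 : B) ≤ a) : IsUnit a := by
  rw [← Algebra.algebraMap_eq_smul_one] at h1
  exact spectrum.isUnit_of_zero_notMem ℝ fun h0 ↦
    hp.not_ge ((algebraMap_le_iff_le_spectrum ha).1 h1 0 h0)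

lemma cfc_le_affine {f : ℝ → ℝ} {α β : ℝ} {a : B} (ha : IsSelfAdjoint a)
    (hf : ContinuousOn f (spectrum ℝ a)) (h : ∀ x ∈ spectrum ℝ a, f x ≤ α + β * x) :
    cfc f a ≤ α • (1 : B) + β • a := by
  rw [← cfc_affine α β ha]
  exact cfc_mono h

lemma affine_le_cfc {f : ℝ → ℝ} {α β : ℝ} {a : B} (ha : IsSelfAdjoint a)
    (hf : ContinuousOn f (spectrum ℝ a)) (h : ∀ x ∈ spectrum ℝ a, α + β * x ≤ f x) :
    α • (1 : B) + β • a ≤ cfc f a := by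
  rw [← cfc_affine α β ha]
  exact cfc_mono h

/-- The chord bound for the inverse on `[p, q]`. -/
lemma ringInverse_le_affine {p q : ℝ} (hp : 0 < p) (hpq : p ≤ q) {a : B}
    (ha : IsSelfAdjoint a) (h1 : p • (1 : B) ≤ a) (h2 : a ≤ q • (1 : B)) :
    Ring.inverse a ≤ ((p + q) / (p * q)) • (1 : B) + (-(1 / (p * q))) • a := by
  have hu := isUnit_of_pos_smul_one_le hp ha h1
  rw [ringInverse_eq_cfc ha hu]
  refine cfc_le_affine ha (continuousOn_inv_spectrum hu) fun x hx ↦ ?_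
  obtain ⟨hx1, hx2⟩ := spectrum_subset_Icc_of_smul_one_le ha h1 h2 hx
  have hx0 : 0 < x := hp.trans_le hx1
  have hq : 0 < q := hp.trans_le hpq
  have : (p + q) / (p * q) + -(1 / (p * q)) * x - x⁻¹ = (x - p) * (q - x) / (p * q * x) := by
    field_simp
    ring
  have : 0 ≤ (x - p) * (q - x) / (p * q * x) :=
    div_nonneg (mul_nonneg (by linarith) (by linarith)) (by positivity)
  linarith

lemma smul_one_le_ringInverse {q : ℝ} {a : B} (ha : 0 ≤ a) (hu : IsUnit a)
    (h2 : a ≤ q • (1 : B)) : q⁻¹ • (1 : B) ≤ Ring.inverse a := by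
  have hsa := IsSelfAdjoint.of_nonneg ha
  rw [← Algebra.algebraMap_eq_smul_one] at h2 ⊢
  rw [ringInverse_eq_cfc hsa hu]
  refine algebraMap_le_cfc _ _ _ (fun x hx ↦ ?_) (continuousOn_inv_spectrum hu) hsa
  have hx0 : 0 < x := (spectrum_nonneg_of_nonneg ha hx).lt_of_ne fun h0 ↦
    spectrum.zero_notMem ℝ hu (h0 ▸ hx)
  exact inv_anti₀ hx0 ((le_algebraMap_iff_spectrum_le hsa).1 h2 x hx)

lemma ringInverse_le_smul_one {p : ℝ} {a : B} (hp : 0 < p) (ha : IsSelfAdjoint a)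
    (h1 : p • (1 : B) ≤ a) : Ring.inverse a ≤ p⁻¹ • (1 : B) := by
  have hu := isUnit_of_pos_smul_one_le hp ha h1
  rw [← Algebra.algebraMap_eq_smul_one] at h1 ⊢
  rw [ringInverse_eq_cfc ha hu]
  exact cfc_le_algebraMap _ _ _
    (fun x hx ↦ inv_anti₀ hp ((algebraMap_le_iff_le_spectrum ha).1 h1 x hx))
    (continuousOn_inv_spectrum hu) ha

lemma weightedSum_le_smul_one (hω0 : ∀ j, 0 ≤ ω j) (hω1 : ∑ j, ω j = 1) {q : ℝ} {A : ι → B}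
    (h2 : ∀ j, A j ≤ q • (1 : B)) : ∑ j, ω j • A j ≤ q • (1 : B) := by
  calc ∑ j, ω j • A j ≤ ∑ j, ω j • (q • (1 : B)) :=
        Finset.sum_le_sum fun j _ ↦ smul_le_smul_of_nonneg_left (h2 j) (hω0 j)
    _ = q • (1 : B) := by rw [← Finset.sum_smul, hω1, one_smul]

lemma smul_one_le_weightedSum (hω0 : ∀ j, 0 ≤ ω j) (hω1 : ∑ j, ω j = 1) {p : ℝ} {A : ι → B}
    (h1 : ∀ j, p • (1 : B) ≤ A j) : p • (1 : B) ≤ ∑ j, ω j • A j := by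
  calc p • (1 : B) = ∑ j, ω j • (p • (1 : B)) := by rw [← Finset.sum_smul, hω1, one_smul]
    _ ≤ ∑ j, ω j • A j :=
        Finset.sum_le_sum fun j _ ↦ smul_le_smul_of_nonneg_left (h1 j) (hω0 j)

lemma smul_one_le_harmonic (hω0 : ∀ j, 0 ≤ ω j) (hω1 : ∑ j, ω j = 1) {p q : ℝ} (hp : 0 < p)
    (hpq : p ≤ q) {A : ι → B} (hA : ∀ j, 0 ≤ A j) (h1 : ∀ j, p • (1 : B) ≤ A j)
    (h2 : ∀ j, A j ≤ q • (1 : B)) :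
    p • (1 : B) ≤ Ring.inverse (∑ j, ω j • Ring.inverse (A j)) := by
  have hq : 0 < q := hp.trans_le hpq
  have hlow : q⁻¹ • (1 : B) ≤ ∑ j, ω j • Ring.inverse (A j) :=
    smul_one_le_weightedSum hω0 hω1 fun j ↦ smul_one_le_ringInverse (hA j)
      (isUnit_of_pos_smul_one_le hp (.of_nonneg (hA j)) (h1 j)) (h2 j)
  have h0 : 0 ≤ ∑ j, ω j • Ring.inverse (A j) :=
    (smul_nonneg (inv_pos.2 hq).le zero_le_one).trans hlow
  have := smul_one_le_ringInverse h0
    (isUnit_of_pos_smul_one_le (inv_pos.2 hq) (.of_nonneg h0) hlow)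
    (weightedSum_le_smul_one hω0 hω1 fun j ↦
      ringInverse_le_smul_one hp (.of_nonneg (hA j)) (h1 j))
  rwa [inv_inv] at this

/-- The Kantorovich inequality between the weighted arithmetic and harmonic means. -/
lemma kantorovich_smul_arithmetic_le_harmonic (hω0 : ∀ j, 0 ≤ ω j) (hω1 : ∑ j, ω j = 1)
    {p q : ℝ} (hp : 0 < p) (hpq : p ≤ q) {A : ι → B} (hA : ∀ j, 0 ≤ A j)
    (h1 : ∀ j, p • (1 : B) ≤ A j) (h2 : ∀ j, A j ≤ q • (1 : B)) :
    (4 * q * p / (q + p) ^ 2) • ∑ j, ω j • A j ≤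
      Ring.inverse (∑ j, ω j • Ring.inverse (A j)) := by
  have hq : 0 < q := hp.trans_le hpq
  set T := ∑ j, ω j • Ring.inverse (A j)
  set S := ∑ j, ω j • A j
  have hlow : q⁻¹ • (1 : B) ≤ T :=
    smul_one_le_weightedSum hω0 hω1 fun j ↦ smul_one_le_ringInverse (hA j)
      (isUnit_of_pos_smul_one_le hp (.of_nonneg (hA j)) (h1 j)) (h2 j)
  have hT0 : 0 ≤ T := (smul_nonneg (inv_pos.2 hq).le zero_le_one).trans hlow
  have hTsa := IsSelfAdjoint.of_nonneg hT0
  have hTu : IsUnit T := isUnit_of_pos_smul_one_le (inv_pos.2 hq) hTsa hlow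
  have hTS : T ≤ ((p + q) / (p * q)) • (1 : B) + (-(1 / (p * q))) • S := by
    rw [← weightedSum_affine hω1]
    exact Finset.sum_le_sum fun j _ ↦ smul_le_smul_of_nonneg_left
      (ringInverse_le_affine hp hpq (.of_nonneg (hA j)) (h1 j) (h2 j)) (hω0 j)
  have hST : (1 / (p * q)) • S ≤ ((p + q) / (p * q)) • (1 : B) + (-1 : ℝ) • T := by
    rw [neg_smul, ← sub_eq_add_neg] at hTS
    rw [neg_one_smul, ← sub_eq_add_neg]
    exact le_sub_comm.1 hTS
  have hc : 0 ≤ 4 * q * p / (q + p) ^ 2 * (p * q) := by positivity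
  have key := smul_le_smul_of_nonneg_left hST hc
  rw [smul_smul, smul_add, smul_smul, smul_smul] at key
  have hcoef : 4 * q * p / (q + p) ^ 2 * (p * q) * (1 / (p * q)) =
      4 * q * p / (q + p) ^ 2 := by field_simp
  rw [hcoef] at key
  refine key.trans ?_
  rw [ringInverse_eq_cfc hTsa hTu]
  refine affine_le_cfc hTsa (continuousOn_inv_spectrum hTu) fun x hx ↦ ?_
  have hx0 : 0 < x := (spectrum_nonneg_of_nonneg hT0 hx).lt_of_ne fun h0 ↦
    spectrum.zero_notMem ℝ hTu (h0 ▸ hx)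
  have hid : x⁻¹ - (4 * q * p / (q + p) ^ 2 * (p * q) * ((p + q) / (p * q)) +
      4 * q * p / (q + p) ^ 2 * (p * q) * -1 * x) =
      ((q + p) - 2 * (p * q) * x) ^ 2 / ((q + p) ^ 2 * x) := by
    field_simp
    ring
  have : 0 ≤ ((q + p) - 2 * (p * q) * x) ^ 2 / ((q + p) ^ 2 * x) := by positivity
  linarith

lemma cfcRpow_mem_bounds {p q r : ℝ} (hp : 0 < p) (hr : 0 ≤ r) {a : B} (ha : 0 ≤ a)
    (h1 : p • (1 : B) ≤ a) (h2 : a ≤ q • (1 : B)) :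
    p ^ r • (1 : B) ≤ CFC.rpow a r ∧ CFC.rpow a r ≤ q ^ r • (1 : B) := by
  have hsa := IsSelfAdjoint.of_nonneg ha
  have hsp := spectrum_subset_Icc_of_smul_one_le hsa h1 h2
  rw [CFC.rpow_eq_pow, CFC.rpow_eq_cfc_real ha, ← Algebra.algebraMap_eq_smul_one,
    ← Algebra.algebraMap_eq_smul_one]
  exact ⟨algebraMap_le_cfc _ _ _ (fun x hx ↦ Real.rpow_le_rpow hp.le (hsp hx).1 hr)
      (continuousOn_rpow_spectrum hr a) hsa,
    cfc_le_algebraMap _ _ _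
      (fun x hx ↦ Real.rpow_le_rpow (hp.le.trans (hsp hx).1) (hsp hx).2 hr)
      (continuousOn_rpow_spectrum hr a) hsa⟩

/-- An operator below a weighted arithmetic mean has its `r`-th power below `K(h, r)` times
the weighted arithmetic mean of the `r`-th powers. -/
lemma cfcRpow_le_Kconst_smul_weightedSum (hω0 : ∀ j, 0 ≤ ω j) (hω1 : ∑ j, ω j = 1)
    {m M r : ℝ} (hm : 0 < m) (hmM : m < M) (hr : 1 ≤ r) {A : ι → B} (hA : ∀ j, 0 ≤ A j)
    (h1 : ∀ j, m • (1 : B) ≤ A j) (h2 : ∀ j, A j ≤ M • (1 : B)) {X : B} (hX : 0 ≤ X)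
    (hX1 : m • (1 : B) ≤ X) (hX2 : X ≤ ∑ j, ω j • A j) :
    CFC.rpow X r ≤ Kconst (M / m) r • ∑ j, ω j • CFC.rpow (A j) r := by
  have hr0 : 0 ≤ r := zero_le_one.trans hr
  obtain ⟨α, β, hβ, haff⟩ := exists_affine_between_rpow hm hmM hr
  have hXsp := spectrum_subset_Icc_of_smul_one_le (.of_nonneg hX) hX1
    (hX2.trans (weightedSum_le_smul_one hω0 hω1 h2))
  calc CFC.rpow X r ≤ α • (1 : B) + β • X := by
        rw [CFC.rpow_eq_pow, CFC.rpow_eq_cfc_real hX]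
        exact cfc_le_affine (.of_nonneg hX) (continuousOn_rpow_spectrum hr0 X)
          fun x hx ↦ (haff x (hXsp hx)).1
    _ ≤ α • (1 : B) + β • ∑ j, ω j • A j := by
        gcongr
    _ = ∑ j, ω j • (α • (1 : B) + β • A j) := (weightedSum_affine hω1 α β A).symm
    _ ≤ ∑ j, ω j • (Kconst (M / m) r • CFC.rpow (A j) r) := by
        refine Finset.sum_le_sum fun j _ ↦ smul_le_smul_of_nonneg_left ?_ (hω0 j)
        have hsa := IsSelfAdjoint.of_nonneg (hA j)
        rw [CFC.rpow_eq_pow, CFC.rpow_eq_cfc_real (hA j),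
          ← cfc_const_mul _ _ _ (continuousOn_rpow_spectrum hr0 (A j))]
        exact affine_le_cfc hsa ((continuousOn_rpow_spectrum hr0 (A j)).const_mul _)
          fun x hx ↦ (haff x (spectrum_subset_Icc_of_smul_one_le hsa (h1 j) (h2 j) hx)).2
    _ = Kconst (M / m) r • ∑ j, ω j • CFC.rpow (A j) r := by
        rw [Finset.smul_sum]
        simp_rw [smul_comm (Kconst (M / m) r)]

end CStar

theorem stmt12
    {H K : Type*}
    [NormedAddCommGroup H] [InnerProductSpace ℂ H] [CompleteSpace H]
    [NormedAddCommGroup K] [InnerProductSpace ℂ K] [CompleteSpace K]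
    {n : ℕ} (ω : Fin n → ℝ) (hω0 : ∀ j, 0 ≤ ω j) (hω1 : ∑ j, ω j = 1)
    (m M : ℝ) (hm : 0 < m) (hmM : m < M)
    (A : Fin n → (H →L[ℂ] H))
    (hA0 : ∀ j, 0 ≤ A j) (hAu : ∀ j, IsUnit (A j))
    (hA1 : ∀ j, m • (1 : H →L[ℂ] H) ≤ A j)
    (hA2 : ∀ j, A j ≤ M • (1 : H →L[ℂ] H))
    (Φ : (H →L[ℂ] H) →ₗ[ℂ] (K →L[ℂ] K))
    (hΦ1 : Φ 1 = 1) (hΦpos : ∀ T : H →L[ℂ] H, 0 ≤ T → 0 ≤ Φ T)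
    (F : (Fin n → (H →L[ℂ] H)) → (H →L[ℂ] H))
    (G : (Fin n → (K →L[ℂ] K)) → (K →L[ℂ] K))
    (hF : IsAHSandwich ω F) (hG : IsAHSandwich ω G)
    (r : ℝ) (hr : 1 ≤ r)
    :
    (4 * M ^ r * m ^ r / (M ^ r + m ^ r) ^ 2 * (Kconst (M / m) (-r))⁻¹ *
        (Kconst (M / m) r)⁻¹) • Φ (CFC.rpow (F A) r) ≤
      G (fun j => Φ (CFC.rpow (A j) r)) := by
  have hr0 : 0 ≤ r := zero_le_one.trans hr
  have hmr : 0 < m ^ r := Real.rpow_pos_of_pos hm r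
  have hmMr : m ^ r ≤ M ^ r := Real.rpow_le_rpow hm.le hmM.le hr0
  have hMr : 0 < M ^ r := hmr.trans_le hmMr
  have hh : 1 < M / m := (one_lt_div hm).2 hmM
  have hK1 : 1 ≤ Kconst (M / m) (-r) := one_le_Kconst hh (Or.inl (by linarith))
  have hK2 : 0 < Kconst (M / m) r := zero_lt_one.trans_le (one_le_Kconst hh (Or.inr hr))
  have hΦmono : ∀ S T : H →L[ℂ] H, S ≤ T → Φ S ≤ Φ T := fun S T hST ↦ by
    have := hΦpos _ (sub_nonneg.2 hST)
    rwa [map_sub, sub_nonneg] at this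
  have hΦsmul : ∀ (c : ℝ) (T : H →L[ℂ] H), Φ (c • T) = c • Φ T :=
    fun c T ↦ LinearMap.map_smul_of_tower Φ c T
  obtain ⟨⟨hF0, -⟩, hF1, hF2⟩ := hF A hA0 hAu
  have hFr := cfcRpow_le_Kconst_smul_weightedSum hω0 hω1 hm hmM hr hA0 hA1 hA2 hF0
    ((smul_one_le_harmonic hω0 hω1 hm hmM.le hA0 hA1 hA2).trans hF1) hF2
  set C : Fin n → (K →L[ℂ] K) := fun j ↦ Φ (CFC.rpow (A j) r)
  have hΦFr : Φ (CFC.rpow (F A) r) ≤ Kconst (M / m) r • ∑ j, ω j • C j := by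
    have := hΦmono _ _ hFr
    rw [hΦsmul, map_sum] at this
    simpa only [hΦsmul] using this
  have hC1 : ∀ j, m ^ r • (1 : K →L[ℂ] K) ≤ C j := fun j ↦ by
    have := hΦmono _ _ (cfcRpow_mem_bounds hm hr0 (hA0 j) (hA1 j) (hA2 j)).1
    rwa [hΦsmul, hΦ1] at this
  have hC2 : ∀ j, C j ≤ M ^ r • (1 : K →L[ℂ] K) := fun j ↦ by
    have := hΦmono _ _ (cfcRpow_mem_bounds hm hr0 (hA0 j) (hA1 j) (hA2 j)).2
    rwa [hΦsmul, hΦ1] at this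
  have hC0 : ∀ j, 0 ≤ C j := fun j ↦ hΦpos _ CFC.rpow_nonneg
  have hCu : ∀ j, IsUnit (C j) := fun j ↦
    isUnit_of_pos_smul_one_le hmr (.of_nonneg (hC0 j)) (hC1 j)
  have hS0 : 0 ≤ ∑ j, ω j • C j :=
    Finset.sum_nonneg fun j _ ↦ smul_nonneg (hω0 j) (hC0 j)
  have hc0 : 0 ≤ 4 * M ^ r * m ^ r / (M ^ r + m ^ r) ^ 2 := by positivity
  calc (4 * M ^ r * m ^ r / (M ^ r + m ^ r) ^ 2 * (Kconst (M / m) (-r))⁻¹ *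
        (Kconst (M / m) r)⁻¹) • Φ (CFC.rpow (F A) r)
      ≤ (4 * M ^ r * m ^ r / (M ^ r + m ^ r) ^ 2 * (Kconst (M / m) (-r))⁻¹ *
        (Kconst (M / m) r)⁻¹) • (Kconst (M / m) r • ∑ j, ω j • C j) :=
        smul_le_smul_of_nonneg_left hΦFr (by positivity)
    _ = (4 * M ^ r * m ^ r / (M ^ r + m ^ r) ^ 2 * (Kconst (M / m) (-r))⁻¹) •
        ∑ j, ω j • C j := by
        rw [smul_smul, inv_mul_cancel_right₀ hK2.ne']
    _ ≤ (4 * M ^ r * m ^ r / (M ^ r + m ^ r) ^ 2) • ∑ j, ω j • C j :=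
        smul_le_smul_of_nonneg_right (mul_le_of_le_one_right hc0 (inv_le_one_of_one_le₀ hK1)) hS0
    _ ≤ Ring.inverse (∑ j, ω j • Ring.inverse (C j)) :=
        kantorovich_smul_arithmetic_le_harmonic hω0 hω1 hmr hmMr hC0 hC1 hC2
    _ ≤ G C := (hG C hC0 hCu).2.1
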